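/- (Theorem 2, case α = 1.) For all x, x' ∈ [−C_q/2, C_q/2], the Kullback–Leibler divergence between the quantized-Gaussian pmfs at x and x' is maximized at the extreme inputs: ∑_{r=0}^{k−1} P_x(r)·log(P_x(r)/P_{x'}(r)) ≤ ∑_{r=0}^{k−1} P_{C_q/2}(r)·log(P_{C_q/2}(r)/P_{−C_q/2}(r)). -/

import Mathlib

open MeasureTheory Real

/-- Density of the normal distribution `N(x, σ²)`. -/
noncomputable def gpdf (σ x t : ℝ) : ℝ :=
  (1 / (σ * Real.sqrt (2 * Real.pi))) * Real.exp (-(t - x) ^ 2 / (2 * σ ^ 2))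

/-- Quantization levels `B(r) = -C_q + r · δ`, with `δ = 2·C_q/(k-1)`. -/
noncomputable def Blev (Cq : ℝ) (k : ℕ) (r : ℕ) : ℝ :=
  -Cq + (r : ℝ) * (2 * Cq / ((k : ℝ) - 1))

/-- The quantized-Gaussian pmf `P_x(r)` on `{0, 1, …, k-1}`. -/
noncomputable def qgPmf (Cq σ : ℝ) (k : ℕ) (x : ℝ) (r : ℕ) : ℝ :=
  if r = 0 then
    (∫ t in Set.Iic (Blev Cq k 0), gpdf σ x t)
      + ∫ t in (Blev Cq k 0)..(Blev Cq k 1),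
          gpdf σ x t * (Blev Cq k 1 - t) / (2 * Cq / ((k : ℝ) - 1))
  else if r = k - 1 then
    (∫ t in (Blev Cq k (k - 2))..(Blev Cq k (k - 1)),
        gpdf σ x t * (t - Blev Cq k (k - 2)) / (2 * Cq / ((k : ℝ) - 1)))
      + ∫ t in Set.Ici (Blev Cq k (k - 1)), gpdf σ x t
  else
    (∫ t in (Blev Cq k (r - 1))..(Blev Cq k r),
        gpdf σ x t * (t - Blev Cq k (r - 1)) / (2 * Cq / ((k : ℝ) - 1)))
      + ∫ t in (Blev Cq k r)..(Blev Cq k (r + 1)),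
          gpdf σ x t * (Blev Cq k (r + 1) - t) / (2 * Cq / ((k : ℝ) - 1))

section LikelihoodRatioOrder

/-- `q` dominates `p` in the likelihood-ratio order on `S`. -/
def LikelihoodRatioLE (S : Finset ℕ) (p q : ℕ → ℝ) : Prop :=
  ∀ r ∈ S, ∀ s ∈ S, s ≤ r → q s * p r ≤ q r * p s

/-- Finite Gibbs inequality: Kullback–Leibler divergence is nonnegative. -/
lemma sum_mul_log_div_nonneg {S : Finset ℕ} {p q : ℕ → ℝ}
    (hp : ∀ r ∈ S, 0 < p r) (hq : ∀ r ∈ S, 0 < q r) (hsum : ∑ r ∈ S, p r = ∑ r ∈ S, q r) :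
    0 ≤ ∑ r ∈ S, q r * Real.log (q r / p r) := by
  have h : ∑ r ∈ S, (q r - p r) ≤ ∑ r ∈ S, q r * Real.log (q r / p r) := by
    refine Finset.sum_le_sum fun r hr => ?_
    have h1 := Real.one_sub_inv_le_log_of_pos (div_pos (hq r hr) (hp r hr))
    have h2 := mul_le_mul_of_nonneg_left h1 (hq r hr).le
    have h3 : q r * (1 - (q r / p r)⁻¹) = q r - p r := by
      have := (hq r hr).ne'
      field_simp
    linarith
  rw [Finset.sum_sub_distrib, hsum, sub_self] at h
  exact h

/-- The likelihood-ratio order implies first-order stochastic dominance. -/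
lemma LikelihoodRatioLE.sum_mul_le_sum_mul {S : Finset ℕ} {q m h : ℕ → ℝ}
    (hqm : LikelihoodRatioLE S q m) (hq : ∑ r ∈ S, q r = 1) (hm : ∑ r ∈ S, m r = 1)
    (hmono : ∀ r ∈ S, ∀ s ∈ S, s ≤ r → h s ≤ h r) :
    ∑ r ∈ S, q r * h r ≤ ∑ r ∈ S, m r * h r := by
  have key : 0 ≤ ∑ r ∈ S, ∑ s ∈ S, (m r * q s - m s * q r) * (h r - h s) := by
    refine Finset.sum_nonneg fun r hr => Finset.sum_nonneg fun s hs => ?_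
    rcases le_total s r with hsr | hrs
    · exact mul_nonneg (sub_nonneg.2 (hqm r hr s hs hsr)) (sub_nonneg.2 (hmono r hr s hs hsr))
    · exact mul_nonneg_of_nonpos_of_nonpos (sub_nonpos.2 (hqm s hs r hr hrs))
        (sub_nonpos.2 (hmono s hs r hr hrs))
  have expand : ∑ r ∈ S, ∑ s ∈ S, (m r * q s - m s * q r) * (h r - h s) =
      2 * ((∑ r ∈ S, m r * h r) * (∑ s ∈ S, q s) -
        (∑ r ∈ S, q r * h r) * (∑ s ∈ S, m s)) := by
    have e : ∀ r s, (m r * q s - m s * q r) * (h r - h s) =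
        (m r * h r) * q s - m r * (q s * h s) - (q r * h r) * m s + q r * (m s * h s) :=
      fun r s => by ring
    simp only [e, Finset.sum_add_distrib, Finset.sum_sub_distrib, ← Finset.sum_mul_sum]
    ring
  rw [expand, hq, hm] at key
  linarith

variable {S : Finset ℕ} {p q m : ℕ → ℝ}

lemma LikelihoodRatioLE.log_div_mono (hpq : LikelihoodRatioLE S p q)
    (hp : ∀ r ∈ S, 0 < p r) (hq : ∀ r ∈ S, 0 < q r) :
    ∀ r ∈ S, ∀ s ∈ S, s ≤ r → Real.log (q s / p s) ≤ Real.log (q r / p r) := by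
  intro r hr s hs hsr
  refine Real.log_le_log (div_pos (hq s hs) (hp s hs)) ?_
  rw [div_le_div_iff₀ (hp s hs) (hp r hr)]
  exact hpq r hr s hs hsr

lemma sum_mul_log_div_add (hp : ∀ r ∈ S, 0 < p r) (hq : ∀ r ∈ S, 0 < q r)
    (hm : ∀ r ∈ S, 0 < m r) :
    ∑ r ∈ S, m r * Real.log (m r / p r) =
      ∑ r ∈ S, m r * Real.log (m r / q r) + ∑ r ∈ S, m r * Real.log (q r / p r) := by
  rw [← Finset.sum_add_distrib]
  refine Finset.sum_congr rfl fun r hr => ?_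
  rw [Real.log_div (hm r hr).ne' (hp r hr).ne', Real.log_div (hm r hr).ne' (hq r hr).ne',
    Real.log_div (hq r hr).ne' (hp r hr).ne']
  ring

/-- Along the likelihood-ratio order, the divergence grows with its first argument. -/
lemma LikelihoodRatioLE.kl_le_kl_left (hpq : LikelihoodRatioLE S p q)
    (hqm : LikelihoodRatioLE S q m) (hp : ∀ r ∈ S, 0 < p r) (hq : ∀ r ∈ S, 0 < q r)
    (hm : ∀ r ∈ S, 0 < m r) (hq1 : ∑ r ∈ S, q r = 1) (hm1 : ∑ r ∈ S, m r = 1) :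
    ∑ r ∈ S, q r * Real.log (q r / p r) ≤ ∑ r ∈ S, m r * Real.log (m r / p r) := by
  have h1 := hqm.sum_mul_le_sum_mul hq1 hm1 (hpq.log_div_mono hp hq)
  have h2 := sum_mul_log_div_nonneg hq hm (hq1.trans hm1.symm)
  rw [sum_mul_log_div_add hp hq hm]
  linarith

/-- Along the likelihood-ratio order, the divergence decreases with its second argument. -/
lemma LikelihoodRatioLE.kl_le_kl_right (hpq : LikelihoodRatioLE S p q)
    (hqm : LikelihoodRatioLE S q m) (hp : ∀ r ∈ S, 0 < p r) (hq : ∀ r ∈ S, 0 < q r)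
    (hm : ∀ r ∈ S, 0 < m r) (hp1 : ∑ r ∈ S, p r = 1) (hq1 : ∑ r ∈ S, q r = 1)
    (hm1 : ∑ r ∈ S, m r = 1) :
    ∑ r ∈ S, m r * Real.log (m r / q r) ≤ ∑ r ∈ S, m r * Real.log (m r / p r) := by
  have h1 := hqm.sum_mul_le_sum_mul hq1 hm1 (hpq.log_div_mono hp hq)
  have h2 := sum_mul_log_div_nonneg hp hq (hp1.trans hq1.symm)
  rw [sum_mul_log_div_add hp hq hm]
  linarith

end LikelihoodRatioOrder

section Gaussian

variable {σ : ℝ}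

lemma gpdf_eq_gaussianPDFReal (hσ : 0 < σ) (x : ℝ) :
    gpdf σ x = ProbabilityTheory.gaussianPDFReal x ⟨σ ^ 2, sq_nonneg σ⟩ := by
  ext t
  have h : √(2 * π * σ ^ 2) = σ * √(2 * π) := by
    rw [Real.sqrt_mul (by positivity), Real.sqrt_sq hσ.le, mul_comm]
  change _ = (√(2 * π * σ ^ 2))⁻¹ * rexp (-(t - x) ^ 2 / (2 * σ ^ 2))
  rw [gpdf, h, one_div]

lemma integrable_gpdf (hσ : 0 < σ) (x : ℝ) : Integrable (gpdf σ x) := by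
  rw [gpdf_eq_gaussianPDFReal hσ]
  exact ProbabilityTheory.integrable_gaussianPDFReal _ _

lemma integral_gpdf (hσ : 0 < σ) (x : ℝ) : ∫ t, gpdf σ x t = 1 := by
  rw [gpdf_eq_gaussianPDFReal hσ]
  refine ProbabilityTheory.integral_gaussianPDFReal_eq_one x fun h => ?_
  exact (pow_pos hσ 2).ne' (congrArg NNReal.toReal h)

lemma gpdf_pos (hσ : 0 < σ) (x t : ℝ) : 0 < gpdf σ x t := by
  unfold gpdf
  positivity

lemma continuous_gpdf (σ x : ℝ) : Continuous (gpdf σ x) := by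
  unfold gpdf
  fun_prop

lemma gpdf_neg_neg (σ x t : ℝ) : gpdf σ (-x) (-t) = gpdf σ x t := by
  unfold gpdf
  congr 3
  ring

/-- The Gaussian location family has monotone likelihood ratios. -/
lemma gpdf_mul_gpdf_le {x y t u : ℝ} (hxy : y ≤ x) (htu : u ≤ t) :
    gpdf σ x u * gpdf σ y t ≤ gpdf σ x t * gpdf σ y u := by
  unfold gpdf
  rw [mul_mul_mul_comm, mul_mul_mul_comm _ (rexp (-(t - x) ^ 2 / (2 * σ ^ 2))), ← Real.exp_add,
    ← Real.exp_add, ← add_div, ← add_div]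
  refine mul_le_mul_of_nonneg_left (Real.exp_le_exp.2 ?_) (mul_self_nonneg _)
  refine div_le_div_of_nonneg_right ?_ (by positivity)
  nlinarith [mul_nonneg (sub_nonneg.2 hxy) (sub_nonneg.2 htu)]

end Gaussian

section Hat

/-- The point `t` clamped to `[-Cq, Cq]`, measured in quantization steps from `-Cq`. -/
noncomputable def clampedLevel (Cq : ℝ) (k : ℕ) (t : ℝ) : ℝ :=
  (max (-Cq) (min Cq t) + Cq) / (2 * Cq / ((k : ℝ) - 1))

/-- Probability of rounding `t` (after clamping) to the level `r`. -/
noncomputable def roundProb (Cq : ℝ) (k r : ℕ) (t : ℝ) : ℝ :=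
  max 0 (1 - |clampedLevel Cq k t - r|)

variable {Cq : ℝ} {k : ℕ}

lemma step_pos (hC : 0 < Cq) (hk : 2 ≤ k) : 0 < 2 * Cq / ((k : ℝ) - 1) := by
  have : (2 : ℝ) ≤ k := by exact_mod_cast hk
  exact div_pos (by linarith) (by linarith)

lemma step_mul (hk : 2 ≤ k) : ((k : ℝ) - 1) * (2 * Cq / ((k : ℝ) - 1)) = 2 * Cq := by
  have : (2 : ℝ) ≤ k := by exact_mod_cast hk
  exact mul_div_cancel₀ _ (by linarith)

lemma clampedLevel_nonneg (hC : 0 < Cq) (hk : 2 ≤ k) (t : ℝ) : 0 ≤ clampedLevel Cq k t :=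
  div_nonneg (by linarith [le_max_left (-Cq) (min Cq t)]) (step_pos hC hk).le

lemma clampedLevel_le (hC : 0 < Cq) (hk : 2 ≤ k) (t : ℝ) : clampedLevel Cq k t ≤ k - 1 := by
  unfold clampedLevel
  rw [div_le_iff₀ (step_pos hC hk), step_mul hk]
  have : max (-Cq) (min Cq t) ≤ Cq := max_le (by linarith) (min_le_left _ _)
  linarith

lemma clampedLevel_mono (hC : 0 < Cq) (hk : 2 ≤ k) : Monotone (clampedLevel Cq k) :=
  fun _ _ h => div_le_div_of_nonneg_right
    (add_le_add_left (max_le_max_left _ (min_le_min_left _ h)) _) (step_pos hC hk).le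

lemma clampedLevel_of_mem (t : ℝ) (ht : -Cq ≤ t) (ht' : t ≤ Cq) :
    clampedLevel Cq k t = (t + Cq) / (2 * Cq / ((k : ℝ) - 1)) := by
  rw [clampedLevel, min_eq_right ht', max_eq_right ht]

lemma clampedLevel_neg (hC : 0 < Cq) (hk : 2 ≤ k) (t : ℝ) :
    clampedLevel Cq k (-t) = k - 1 - clampedLevel Cq k t := by
  have h : max (-Cq) (min Cq (-t)) = -max (-Cq) (min Cq t) := by grind
  unfold clampedLevel
  rw [h, eq_sub_iff_add_eq, ← add_div, div_eq_iff (step_pos hC hk).ne', step_mul hk]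
  ring

lemma roundProb_nonneg (r : ℕ) (t : ℝ) : 0 ≤ roundProb Cq k r t := le_max_left _ _

lemma roundProb_le_one (r : ℕ) (t : ℝ) : roundProb Cq k r t ≤ 1 :=
  max_le zero_le_one (by linarith [abs_nonneg (clampedLevel Cq k t - r)])

lemma continuous_roundProb (Cq : ℝ) (k r : ℕ) : Continuous (roundProb Cq k r) := by
  unfold roundProb clampedLevel
  fun_prop

lemma sum_hat_eq {v : ℝ} (hv : 0 ≤ v) (n : ℕ) :
    ∑ r ∈ Finset.range n, max 0 (1 - |v - r|) = min 1 (max 0 (n - v)) := by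
  induction n with
  | zero => simp [hv]
  | succ n ih =>
    rw [Finset.sum_range_succ, ih]
    have hn : n = 0 ∨ (1 : ℝ) ≤ n := by
      rcases Nat.eq_zero_or_pos n with h | h
      · exact Or.inl h
      · exact Or.inr (by exact_mod_cast h)
    push_cast
    rcases hn with rfl | hn
    · simp only [CharP.cast_eq_zero]
      grind
    · grind

lemma sum_roundProb (hC : 0 < Cq) (hk : 2 ≤ k) (t : ℝ) :
    ∑ r ∈ Finset.range k, roundProb Cq k r t = 1 := by
  unfold roundProb
  rw [sum_hat_eq (clampedLevel_nonneg hC hk t)]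
  have := clampedLevel_le hC hk t
  exact min_eq_left (le_max_of_le_right (by linarith))

lemma roundProb_neg (hC : 0 < Cq) (hk : 2 ≤ k) {r : ℕ} (hr : r < k) (t : ℝ) :
    roundProb Cq k (k - 1 - r) (-t) = roundProb Cq k r t := by
  have h : ((k - 1 - r : ℕ) : ℝ) = k - 1 - r := by
    rw [Nat.cast_sub (by omega), Nat.cast_sub (by omega), Nat.cast_one]
  unfold roundProb
  rw [clampedLevel_neg hC hk, h, ← abs_neg]
  congr 3
  ring

/-- The rounding kernel is totally positive of order two. -/
lemma roundProb_mul_roundProb_le (hC : 0 < Cq) (hk : 2 ≤ k) {r s : ℕ} (hsr : s ≤ r) {t u : ℝ}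
    (htu : u ≤ t) :
    roundProb Cq k s t * roundProb Cq k r u ≤ roundProb Cq k r t * roundProb Cq k s u := by
  rcases hsr.eq_or_lt with rfl | hlt
  · exact le_rfl
  have hr0 := mul_nonneg (roundProb_nonneg (Cq := Cq) (k := k) r t)
    (roundProb_nonneg (Cq := Cq) (k := k) s u)
  have hab := clampedLevel_mono hC hk htu
  unfold roundProb at hr0 ⊢
  generalize clampedLevel Cq k t = a at *
  generalize clampedLevel Cq k u = b at *
  rcases le_or_gt (1 - |a - s|) 0 with h1 | h1
  · simpa [max_eq_left h1] using hr0
  rcases le_or_gt (1 - |b - r|) 0 with h2 | h2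
  · simpa [max_eq_left h2] using hr0
  have ha := abs_lt.1 (sub_pos.1 h1)
  have hb := abs_lt.1 (sub_pos.1 h2)
  have hrs : r < s + 2 := by
    have : (r : ℝ) < s + 2 := by linarith
    exact_mod_cast this
  obtain rfl : r = s + 1 := by omega
  push_cast at *
  have e1 : |a - s| = a - s := abs_of_nonneg (by linarith)
  have e2 : |b - s| = b - s := abs_of_nonneg (by linarith)
  have e3 : |a - (s + 1)| = -(a - (s + 1)) := abs_of_nonpos (by linarith)
  have e4 : |b - (s + 1)| = -(b - (s + 1)) := abs_of_nonpos (by linarith)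
  rw [e1, e2, e3, e4, max_eq_right (by linarith), max_eq_right (by linarith),
    max_eq_right (by linarith), max_eq_right (by linarith)]
  nlinarith

lemma Blev_succ (Cq : ℝ) (k r : ℕ) :
    Blev Cq k (r + 1) = Blev Cq k r + 2 * Cq / ((k : ℝ) - 1) := by
  unfold Blev
  push_cast
  ring

lemma Blev_mono (hC : 0 < Cq) (hk : 2 ≤ k) : Monotone (Blev Cq k) :=
  monotone_nat_of_le_succ fun r => by
    rw [Blev_succ]
    linarith [step_pos hC hk]

lemma Blev_zero : Blev Cq k 0 = -Cq := by simp [Blev]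

lemma Blev_sub_one (hk : 2 ≤ k) : Blev Cq k (k - 1) = Cq := by
  have : ((k - 1 : ℕ) : ℝ) = k - 1 := by
    rw [Nat.cast_sub (by omega), Nat.cast_one]
  rw [Blev, this, step_mul hk]
  ring

lemma Blev_mem (hC : 0 < Cq) (hk : 2 ≤ k) {r : ℕ} (hr : r < k) :
    -Cq ≤ Blev Cq k r ∧ Blev Cq k r ≤ Cq := by
  have h0 := Blev_mono hC hk (Nat.zero_le r)
  have h1 := Blev_mono hC hk (Nat.le_sub_one_of_lt hr)
  rw [Blev_zero] at h0
  rw [Blev_sub_one hk] at h1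
  exact ⟨h0, h1⟩

lemma clampedLevel_Blev (hC : 0 < Cq) (hk : 2 ≤ k) {r : ℕ} (hr : r < k) :
    clampedLevel Cq k (Blev Cq k r) = r := by
  obtain ⟨h0, h1⟩ := Blev_mem hC hk hr
  rw [clampedLevel_of_mem _ h0 h1, div_eq_iff (step_pos hC hk).ne', Blev]
  ring

lemma roundProb_eq_zero_of_le (hC : 0 < Cq) (hk : 2 ≤ k) {r : ℕ} (hr : r + 1 < k) {t : ℝ}
    (ht : t ≤ Blev Cq k r) : roundProb Cq k (r + 1) t = 0 := by
  have h := clampedLevel_mono hC hk ht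
  rw [clampedLevel_Blev hC hk (by omega)] at h
  refine max_eq_left ?_
  push_cast
  rw [abs_of_nonpos (by linarith)]
  linarith

lemma roundProb_eq_zero_of_ge (hC : 0 < Cq) (hk : 2 ≤ k) {r : ℕ} (hr : r + 1 < k) {t : ℝ}
    (ht : Blev Cq k (r + 1) ≤ t) : roundProb Cq k r t = 0 := by
  have h := clampedLevel_mono hC hk ht
  rw [clampedLevel_Blev hC hk hr] at h
  push_cast at h
  refine max_eq_left ?_
  rw [abs_of_nonneg (by linarith)]
  linarith

lemma roundProb_left (hC : 0 < Cq) (hk : 2 ≤ k) {r : ℕ} (hr : r + 1 < k) {t : ℝ}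
    (ht : Blev Cq k r ≤ t) (ht' : t ≤ Blev Cq k (r + 1)) :
    roundProb Cq k r t = (Blev Cq k (r + 1) - t) / (2 * Cq / ((k : ℝ) - 1)) := by
  have h := clampedLevel_mono hC hk ht
  have h' := clampedLevel_mono hC hk ht'
  rw [clampedLevel_Blev hC hk (by omega)] at h
  rw [clampedLevel_Blev hC hk hr] at h'
  push_cast at h'
  have e := clampedLevel_of_mem (k := k) t ((Blev_mem hC hk (by omega)).1.trans ht)
    (ht'.trans (Blev_mem hC hk hr).2)
  rw [eq_div_iff (step_pos hC hk).ne'] at e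
  rw [roundProb, abs_of_nonneg (by linarith), max_eq_right (by linarith),
    eq_div_iff (step_pos hC hk).ne', Blev]
  push_cast
  linear_combination -e

lemma roundProb_right (hC : 0 < Cq) (hk : 2 ≤ k) {r : ℕ} (hr : r + 1 < k) {t : ℝ}
    (ht : Blev Cq k r ≤ t) (ht' : t ≤ Blev Cq k (r + 1)) :
    roundProb Cq k (r + 1) t = (t - Blev Cq k r) / (2 * Cq / ((k : ℝ) - 1)) := by
  have h := clampedLevel_mono hC hk ht
  have h' := clampedLevel_mono hC hk ht'
  rw [clampedLevel_Blev hC hk (by omega)] at h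
  rw [clampedLevel_Blev hC hk hr] at h'
  push_cast at h'
  have e := clampedLevel_of_mem (k := k) t ((Blev_mem hC hk (by omega)).1.trans ht)
    (ht'.trans (Blev_mem hC hk hr).2)
  rw [eq_div_iff (step_pos hC hk).ne'] at e
  rw [roundProb]
  push_cast
  rw [abs_of_nonpos (by linarith), max_eq_right (by linarith),
    eq_div_iff (step_pos hC hk).ne', Blev]
  linear_combination e

lemma roundProb_zero_of_le {t : ℝ} (ht : t ≤ Blev Cq k 0) :
    roundProb Cq k 0 t = 1 := by
  rw [Blev_zero] at ht
  have : max (-Cq) (min Cq t) = -Cq := max_eq_left ((min_le_right _ _).trans ht)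
  simp [roundProb, clampedLevel, this]

lemma roundProb_last_of_ge (hC : 0 < Cq) (hk : 2 ≤ k) {t : ℝ} (ht : Blev Cq k (k - 1) ≤ t) :
    roundProb Cq k (k - 1) t = 1 := by
  have h := clampedLevel_mono hC hk ht
  rw [clampedLevel_Blev hC hk (by omega)] at h
  have h' := clampedLevel_le hC hk t
  have e : ((k - 1 : ℕ) : ℝ) = k - 1 := by
    rw [Nat.cast_sub (by omega), Nat.cast_one]
  rw [e] at h
  rw [roundProb, e, le_antisymm h' h]
  simp

end Hat

section Pmf

variable {Cq σ : ℝ} {k : ℕ}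

lemma integrable_gpdf_mul_roundProb (hσ : 0 < σ) (x : ℝ) (r : ℕ) :
    Integrable fun t => gpdf σ x t * roundProb Cq k r t := by
  refine (integrable_gpdf hσ x).mul_bdd (c := 1) (continuous_roundProb Cq k r).aestronglyMeasurable
    (Filter.Eventually.of_forall fun t => ?_)
  rw [Real.norm_of_nonneg (roundProb_nonneg r t)]
  exact roundProb_le_one r t

lemma integral_eq_Iic_add_interval_add_Ioi {g : ℝ → ℝ} (hg : Integrable g) (a b : ℝ) :
    ∫ t, g t = (∫ t in Set.Iic a, g t) + (∫ t in a..b, g t) + ∫ t in Set.Ioi b, g t := by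
  rw [← intervalIntegral.integral_Iic_sub_Iic hg.integrableOn hg.integrableOn,
    ← intervalIntegral.integral_Iic_add_Ioi (b := b) hg.integrableOn hg.integrableOn]
  ring

lemma integral_left (hC : 0 < Cq) (hk : 2 ≤ k) (σ x : ℝ) {r : ℕ} (hr : r + 1 < k) :
    ∫ t in (Blev Cq k r)..(Blev Cq k (r + 1)), gpdf σ x t * roundProb Cq k r t =
      ∫ t in (Blev Cq k r)..(Blev Cq k (r + 1)),
        gpdf σ x t * (Blev Cq k (r + 1) - t) / (2 * Cq / ((k : ℝ) - 1)) := by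
  refine intervalIntegral.integral_congr fun t ht => ?_
  rw [Set.uIcc_of_le (Blev_mono hC hk r.le_succ)] at ht
  simp only [roundProb_left hC hk hr ht.1 ht.2, mul_div_assoc]

lemma integral_right (hC : 0 < Cq) (hk : 2 ≤ k) (σ x : ℝ) {r : ℕ} (hr : r + 1 < k) :
    ∫ t in (Blev Cq k r)..(Blev Cq k (r + 1)), gpdf σ x t * roundProb Cq k (r + 1) t =
      ∫ t in (Blev Cq k r)..(Blev Cq k (r + 1)),
        gpdf σ x t * (t - Blev Cq k r) / (2 * Cq / ((k : ℝ) - 1)) := by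
  refine intervalIntegral.integral_congr fun t ht => ?_
  rw [Set.uIcc_of_le (Blev_mono hC hk r.le_succ)] at ht
  simp only [roundProb_right hC hk hr ht.1 ht.2, mul_div_assoc]

lemma integral_Iic_eq_zero (hC : 0 < Cq) (hk : 2 ≤ k) (σ x : ℝ) {r : ℕ} (hr : r + 1 < k) :
    ∫ t in Set.Iic (Blev Cq k r), gpdf σ x t * roundProb Cq k (r + 1) t = 0 :=
  setIntegral_eq_zero_of_forall_eq_zero fun t ht => by
    rw [roundProb_eq_zero_of_le hC hk hr ht, mul_zero]

lemma integral_Ioi_eq_zero (hC : 0 < Cq) (hk : 2 ≤ k) (σ x : ℝ) {r : ℕ} (hr : r + 1 < k) :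
    ∫ t in Set.Ioi (Blev Cq k (r + 1)), gpdf σ x t * roundProb Cq k r t = 0 :=
  setIntegral_eq_zero_of_forall_eq_zero fun t ht => by
    rw [roundProb_eq_zero_of_ge hC hk hr (le_of_lt ht), mul_zero]

/-- The quantized pmf is the Gaussian mixture of the rounding probabilities. -/
lemma qgPmf_eq_integral (hC : 0 < Cq) (hσ : 0 < σ) (hk : 2 ≤ k) (x : ℝ) {r : ℕ} (hr : r < k) :
    qgPmf Cq σ k x r = ∫ t, gpdf σ x t * roundProb Cq k r t := by
  have hint := integrable_gpdf_mul_roundProb (Cq := Cq) (k := k) hσ x r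
  rcases r with _ | r
  · rw [integral_eq_Iic_add_interval_add_Ioi hint (Blev Cq k 0) (Blev Cq k (0 + 1)),
      integral_left hC hk σ x (by omega), integral_Ioi_eq_zero hC hk σ x (by omega), add_zero,
      qgPmf, if_pos rfl]
    congr 1
    refine setIntegral_congr_fun measurableSet_Iic fun t ht => ?_
    simp only [roundProb_zero_of_le ht, mul_one]
  · rw [integral_eq_Iic_add_interval_add_Ioi hint (Blev Cq k r) (Blev Cq k (r + 1)),
      integral_right hC hk σ x hr, integral_Iic_eq_zero hC hk σ x hr, zero_add,
      qgPmf, if_neg r.succ_ne_zero]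
    split_ifs with hlast
    · have h2 : k - 2 = r := by omega
      rw [← hlast, h2, integral_Ici_eq_integral_Ioi]
      congr 1
      refine setIntegral_congr_fun measurableSet_Ioi fun t ht => ?_
      have : roundProb Cq k (r + 1) t = 1 := by
        rw [hlast] at ht ⊢
        exact roundProb_last_of_ge hC hk (le_of_lt ht)
      simp only [this, mul_one]
    · rw [Nat.add_sub_cancel]
      congr 1
      rw [← integral_left hC hk σ x (by omega),
        ← intervalIntegral.integral_Ioi_sub_Ioi hint.integrableOn
          (Blev_mono hC hk (r + 1).le_succ),
        integral_Ioi_eq_zero hC hk σ x (by omega), sub_zero]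

lemma qgPmf_pos (hC : 0 < Cq) (hσ : 0 < σ) (hk : 2 ≤ k) (x : ℝ) {r : ℕ} (hr : r < k) :
    0 < qgPmf Cq σ k x r := by
  rw [qgPmf_eq_integral hC hσ hk x hr]
  refine integral_pos_of_integrable_nonneg_nonzero (x := Blev Cq k r)
    ((continuous_gpdf σ x).mul (continuous_roundProb Cq k r))
    (integrable_gpdf_mul_roundProb hσ x r)
    (fun t => mul_nonneg (gpdf_pos hσ x t).le (roundProb_nonneg r t)) ?_
  rw [roundProb, clampedLevel_Blev hC hk hr]
  simpa using (gpdf_pos hσ x _).ne'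

lemma sum_qgPmf (hC : 0 < Cq) (hσ : 0 < σ) (hk : 2 ≤ k) (x : ℝ) :
    ∑ r ∈ Finset.range k, qgPmf Cq σ k x r = 1 := by
  rw [Finset.sum_congr rfl fun r hr => qgPmf_eq_integral hC hσ hk x (Finset.mem_range.1 hr),
    ← integral_finsetSum _ fun r _ => integrable_gpdf_mul_roundProb hσ x r]
  simp only [← Finset.mul_sum, sum_roundProb hC hk, mul_one, integral_gpdf hσ]

lemma qgPmf_neg (hC : 0 < Cq) (hσ : 0 < σ) (hk : 2 ≤ k) (x : ℝ) {r : ℕ} (hr : r < k) :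
    qgPmf Cq σ k (-x) (k - 1 - r) = qgPmf Cq σ k x r := by
  rw [qgPmf_eq_integral hC hσ hk _ (by omega), qgPmf_eq_integral hC hσ hk _ hr,
    ← integral_neg_eq_self]
  simp only [gpdf_neg_neg, roundProb_neg hC hk hr]

lemma integral_sub_sub_add {α : Type*} [MeasurableSpace α] {μ : Measure α} {f g h l : α → ℝ}
    (hf : Integrable f μ) (hg : Integrable g μ) (hh : Integrable h μ) (hl : Integrable l μ) :
    ∫ z, (f z - g z - h z + l z) ∂μ =
      ∫ z, f z ∂μ - ∫ z, g z ∂μ - ∫ z, h z ∂μ + ∫ z, l z ∂μ := by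
  rw [← integral_sub' hf hg, ← integral_sub' (hf.sub hg) hh,
    ← integral_add' ((hf.sub hg).sub hh) hl]
  rfl

/-- Quantized Gaussians increase in the likelihood-ratio order with their location. -/
lemma likelihoodRatioLE_qgPmf (hC : 0 < Cq) (hσ : 0 < σ) (hk : 2 ≤ k) {x y : ℝ} (hxy : y ≤ x) :
    LikelihoodRatioLE (Finset.range k) (qgPmf Cq σ k y) (qgPmf Cq σ k x) := by
  intro r hr s hs hsr
  rw [Finset.mem_range] at hr hs
  have hI : ∀ (z : ℝ) (n : ℕ), Integrable fun t => gpdf σ z t * roundProb Cq k n t :=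
    fun z n => integrable_gpdf_mul_roundProb hσ z n
  have key : 0 ≤ ∫ z : ℝ × ℝ, (gpdf σ x z.1 * gpdf σ y z.2 - gpdf σ x z.2 * gpdf σ y z.1) *
      (roundProb Cq k r z.1 * roundProb Cq k s z.2 -
        roundProb Cq k s z.1 * roundProb Cq k r z.2) := by
    refine integral_nonneg fun z => ?_
    rcases le_total z.2 z.1 with h | h
    · exact mul_nonneg (sub_nonneg.2 (gpdf_mul_gpdf_le hxy h))
        (sub_nonneg.2 (roundProb_mul_roundProb_le hC hk hsr h))
    · refine mul_nonneg_of_nonpos_of_nonpos (sub_nonpos.2 (gpdf_mul_gpdf_le hxy h))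
        (sub_nonpos.2 ?_)
      linarith [roundProb_mul_roundProb_le hC hk hsr h]
  have expand : ∀ z : ℝ × ℝ, (gpdf σ x z.1 * gpdf σ y z.2 - gpdf σ x z.2 * gpdf σ y z.1) *
      (roundProb Cq k r z.1 * roundProb Cq k s z.2 -
        roundProb Cq k s z.1 * roundProb Cq k r z.2) =
      (gpdf σ x z.1 * roundProb Cq k r z.1) * (gpdf σ y z.2 * roundProb Cq k s z.2)
      - (gpdf σ x z.1 * roundProb Cq k s z.1) * (gpdf σ y z.2 * roundProb Cq k r z.2)
      - (gpdf σ y z.1 * roundProb Cq k r z.1) * (gpdf σ x z.2 * roundProb Cq k s z.2)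
      + (gpdf σ y z.1 * roundProb Cq k s z.1) * (gpdf σ x z.2 * roundProb Cq k r z.2) :=
    fun z => by ring
  have hP := fun (a b : ℝ) (m n : ℕ) => (hI a m).mul_prod (hI b n)
  simp only [expand] at key
  rw [Measure.volume_eq_prod,
    integral_sub_sub_add (hP x y r s) (hP x y s r) (hP y x r s) (hP y x s r)] at key
  have hprod : ∀ (a b : ℝ) (m n : ℕ), ∫ z : ℝ × ℝ, (gpdf σ a z.1 * roundProb Cq k m z.1) *
      (gpdf σ b z.2 * roundProb Cq k n z.2) ∂(volume.prod volume) =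
      (∫ t, gpdf σ a t * roundProb Cq k m t) * ∫ t, gpdf σ b t * roundProb Cq k n t :=
    fun a b m n => integral_prod_mul (fun t => gpdf σ a t * roundProb Cq k m t)
      (fun t => gpdf σ b t * roundProb Cq k n t)
  simp only [hprod, ← qgPmf_eq_integral hC hσ hk _ hr, ← qgPmf_eq_integral hC hσ hk _ hs] at key
  linarith

lemma kl_qgPmf_le (hC : 0 < Cq) (hσ : 0 < σ) (hk : 2 ≤ k) {a b x y : ℝ} (hay : a ≤ y)
    (hyx : y ≤ x) (hxb : x ≤ b) :
    ∑ r ∈ Finset.range k, qgPmf Cq σ k x r * Real.log (qgPmf Cq σ k x r / qgPmf Cq σ k y r) ≤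
      ∑ r ∈ Finset.range k,
        qgPmf Cq σ k b r * Real.log (qgPmf Cq σ k b r / qgPmf Cq σ k a r) := by
  have hpos : ∀ z, ∀ r ∈ Finset.range k, 0 < qgPmf Cq σ k z r :=
    fun z r hr => qgPmf_pos hC hσ hk z (Finset.mem_range.1 hr)
  have hone := sum_qgPmf hC hσ hk
  exact ((likelihoodRatioLE_qgPmf hC hσ hk hyx).kl_le_kl_left
    (likelihoodRatioLE_qgPmf hC hσ hk hxb) (hpos y) (hpos x) (hpos b) (hone x) (hone b)).trans
    ((likelihoodRatioLE_qgPmf hC hσ hk hay).kl_le_kl_right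
      (likelihoodRatioLE_qgPmf hC hσ hk (hyx.trans hxb)) (hpos a) (hpos y) (hpos b)
      (hone a) (hone y) (hone b))

lemma kl_qgPmf_neg_neg (hC : 0 < Cq) (hσ : 0 < σ) (hk : 2 ≤ k) (x y : ℝ) :
    ∑ r ∈ Finset.range k,
        qgPmf Cq σ k (-x) r * Real.log (qgPmf Cq σ k (-x) r / qgPmf Cq σ k (-y) r) =
      ∑ r ∈ Finset.range k, qgPmf Cq σ k x r * Real.log (qgPmf Cq σ k x r / qgPmf Cq σ k y r) := by
  rw [← Finset.sum_range_reflect]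
  refine Finset.sum_congr rfl fun r hr => ?_
  rw [Finset.mem_range] at hr
  rw [qgPmf_neg hC hσ hk x hr, qgPmf_neg hC hσ hk y hr]

end Pmf

/-- Theorem 2, case `α = 1`: for all `x, x' ∈ [-C_q/2, C_q/2]`, the KL divergence
between the quantized-Gaussian pmfs at `x` and `x'` is maximized at the extreme
inputs `C_q/2` and `-C_q/2`. -/
theorem quantGauss_kl_le_extreme (Cq σ : ℝ) (hC : 0 < Cq) (hσ : 0 < σ)
    (k : ℕ) (hk : 2 ≤ k) (x x' : ℝ)
    (hx : x ∈ Set.Icc (-(Cq / 2)) (Cq / 2)) (hx' : x' ∈ Set.Icc (-(Cq / 2)) (Cq / 2)) :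
    ∑ r ∈ Finset.range k,
        qgPmf Cq σ k x r * Real.log (qgPmf Cq σ k x r / qgPmf Cq σ k x' r)
      ≤ ∑ r ∈ Finset.range k,
          qgPmf Cq σ k (Cq / 2) r *
            Real.log (qgPmf Cq σ k (Cq / 2) r / qgPmf Cq σ k (-(Cq / 2)) r) := by
  rcases le_total x' x with h | h
  · exact kl_qgPmf_le hC hσ hk hx'.1 h hx.2
  · rw [← kl_qgPmf_neg_neg hC hσ hk x x']
    exact kl_qgPmf_le hC hσ hk (neg_le_neg hx'.2) (neg_le_neg h) (neg_le.1 hx.1)
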